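/- arXiv:2412.02079 — 5 statements merged into one kernel-verified Lean document; each statement's English description precedes it below -/
import Mathlib

section
/- Suppose a CAT trajectory satisfies Assumption 1 with constants L, Δ_f ∈ (0,∞). Then for all i ∈ ℕ with τ(i) < ∞, we have π(i+1) < ∞, and for every integer t with τ(i) ≤ t ≤ π(i+1) − 2: t + 2 − τ(i) ≤ log_{ω₁}(ω₂³·max{r₁, 2·d_max(π(i))}/d_min(π(i))) + 4·log_{ω₁}(ω₁ω₂)·(f(x_{π(i)}) − f(x_t))/(βθ·ε_{π(i)}·d_min(π(i))), where d_min(k) := γ₂ω₁⁻¹C^{−1/2}L^{−1/2}ε_k^{1/2} and d_max(k) := (2ω₂/(βθ))·Δ_f/ε_k. -/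
open scoped RealInnerProductSpace
open Filter

noncomputable section

/-- Application of the Hessian-based quadratic model's gradient:
`∇M_x(d) = ∇²f(x) d + ∇f(x)`. -/
def gradModel {n : ℕ} (f : EuclideanSpace ℝ (Fin n) → ℝ)
    (x d : EuclideanSpace ℝ (Fin n)) : EuclideanSpace ℝ (Fin n) :=
  fderiv ℝ (gradient f) x d + gradient f x

/-- The quadratic model `M_x(d) = (1/2) dᵀ ∇²f(x) d + ∇f(x)ᵀ d`. -/
def modelVal {n : ℕ} (f : EuclideanSpace ℝ (Fin n) → ℝ)
    (x d : EuclideanSpace ℝ (Fin n)) : ℝ :=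
  (1/2) * ⟪fderiv ℝ (gradient f) x d, d⟫ + ⟪gradient f x, d⟫

/-- The ratio `ρ̂` of actual to (modified) predicted reduction; equals `0` when the
denominator is `0` (division by zero convention). -/
def rhoHat {n : ℕ} (θ : ℝ) (f : EuclideanSpace ℝ (Fin n) → ℝ)
    (x d : EuclideanSpace ℝ (Fin n)) : ℝ :=
  (f x - f (x + d)) /
    (-(modelVal f x d) + (θ/2) * min ‖gradient f x‖ ‖gradient f (x + d)‖ * ‖d‖)

/-- A CAT trajectory (Algorithm 1, with `σ = 0`): sequences of iterates `x`, directions `d`,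
radii `r`, multipliers `δ`, gradient-norm estimates `ε` and thresholds `b` (in `(0,∞]`,
modeled as `EReal`), indexed from `k = 1`. -/
structure CATTraj {n : ℕ} (θ β ω₁ ω₂ γ₁ γ₂ γ₃ ξ : ℝ)
    (f : EuclideanSpace ℝ (Fin n) → ℝ)
    (x d : ℕ → EuclideanSpace ℝ (Fin n))
    (r δ ε : ℕ → ℝ) (b : ℕ → EReal) : Prop where
  hf : ∀ y, DifferentiableAt ℝ f y
  hf' : ∀ y, DifferentiableAt ℝ (gradient f) y
  r_pos : ∀ k, 1 ≤ k → 0 < r k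
  δ_nonneg : ∀ k, 1 ≤ k → 0 ≤ δ k
  ε_pos : ∀ k, 1 ≤ k → 0 < ε k
  b_pos : ∀ k, 1 ≤ k → 0 < b k
  sub_grad : ∀ k, 1 ≤ k → ‖gradModel f (x k) (d k) + δ k • d k‖ ≤ γ₁ * ε k
  sub_comp : ∀ k, 1 ≤ k → γ₂ * δ k * r k ≤ δ k * ‖d k‖
  sub_rad : ∀ k, 1 ≤ k → ‖d k‖ ≤ r k
  sub_decr : ∀ k, 1 ≤ k → modelVal f (x k) (d k) ≤ -(γ₃ * (δ k / 2) * ‖d k‖ ^ 2)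
  step_acc : ∀ k, 1 ≤ k → f (x k + d k) ≤ f (x k) → x (k+1) = x k + d k
  step_rej : ∀ k, 1 ≤ k → ¬ f (x k + d k) ≤ f (x k) → x (k+1) = x k
  radius_succ : ∀ k, 1 ≤ k → β ≤ rhoHat θ f (x k) (d k) →
    r (k+1) = max (ω₂ * ‖d k‖) (r k)
  radius_fail : ∀ k, 1 ≤ k → ¬ β ≤ rhoHat θ f (x k) (d k) → r (k+1) = r k / ω₁
  eps_one : ε 1 = ‖gradient f (x 1)‖
  eps_succ_dec : ∀ k, 1 ≤ k → (f (x k + d k) : EReal) ≤ (f (x k) : EReal) + b k →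
    ε (k+1) = min (ε k) ‖gradient f (x k + d k)‖
  eps_succ_keep : ∀ k, 1 ≤ k → ¬ ((f (x k + d k) : EReal) ≤ (f (x k) : EReal) + b k) →
    ε (k+1) = ε k
  b_lb : ∀ k, 1 ≤ k → ((ξ * ε k * ‖d k‖ : ℝ) : EReal) ≤ b k

/-- Assumption 1: bounded optimality gap along the trajectory, and the two
Lipschitz-Hessian-type inequalities along the steps. -/
def Assumption1 {n : ℕ} (L Δf : ℝ) (f : EuclideanSpace ℝ (Fin n) → ℝ)
    (x d : ℕ → EuclideanSpace ℝ (Fin n)) : Prop :=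
  ∀ k, 1 ≤ k →
    f (x 1) - f (x k) ≤ Δf ∧
    ‖gradient f (x k + d k)‖ ≤ ‖gradModel f (x k) (d k)‖ + (L/2) * ‖d k‖ ^ 2 ∧
    f (x k + d k) ≤ f (x k) + modelVal f (x k) (d k) + (L/6) * ‖d k‖ ^ 3

/-- `c₁ := (2 + 3γ₃(1−β))/(6(γ₃(1−β) − βθ))`. -/
def c1Def (θ β γ₃ : ℝ) : ℝ := (2 + 3 * γ₃ * (1 - β)) / (6 * (γ₃ * (1 - β) - β * θ))

/-- `c₂ := γ₃(1−β)/(γ₃(1−β) − βθ)`. -/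
def c2Def (θ β γ₃ : ℝ) : ℝ := γ₃ * (1 - β) / (γ₃ * (1 - β) - β * θ)

/-- `C := max{1/(3ξ), 2c₁/(1 − 2γ₁c₂)}`. -/
def CDef (θ β γ₃ γ₁ ξ : ℝ) : ℝ :=
  max (1 / (3 * ξ)) (2 * c1Def θ β γ₃ / (1 - 2 * γ₁ * c2Def θ β γ₃))

/-- `d_min` as a function of the value `e = ε_k`:
`γ₂ ω₁⁻¹ C^{-1/2} L^{-1/2} e^{1/2}`. -/
def dminDef (γ₂ ω₁ C L e : ℝ) : ℝ :=
  γ₂ * ω₁⁻¹ * (Real.sqrt C)⁻¹ * (Real.sqrt L)⁻¹ * Real.sqrt e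

/-- `d_max` as a function of the value `e = ε_k`: `(2ω₂/(βθ)) Δf / e`. -/
def dmaxDef (ω₂ β θ Δf e : ℝ) : ℝ := (2 * ω₂ / (β * θ)) * (Δf / e)

/-- One step of the `π` recursion: the least index `m ≥ 1` with `ε_m < ε_p / 2`
(`⊤` if there is none or if the previous index was `⊤`). -/
def nextPi (ε : ℕ → ℝ) (p : ℕ∞) : ℕ∞ :=
  if p = ⊤ then ⊤
  else sInf ((fun m : ℕ => (m : ℕ∞)) '' {m : ℕ | 1 ≤ m ∧ ε m < ε p.toNat / 2})

/-- `π(1) = 1` and, for `i > 1`, `π(i)` is the least `j` with `ε_j < ε_{π(i−1)}/2`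
(`⊤` if none exists). -/
def piIdx (ε : ℕ → ℝ) : ℕ → ℕ∞
  | 0 => 1
  | 1 => 1
  | (i+2) => nextPi ε (piIdx ε (i+1))

/-- `τ(i) := min({j ≥ π(i) : ‖d_j‖ ≥ d_min(π(i))} ∪ {π(i+1)})`. -/
def tauIdx {n : ℕ} (γ₂ ω₁ C L : ℝ)
    (d : ℕ → EuclideanSpace ℝ (Fin n)) (ε : ℕ → ℝ) (i : ℕ) : ℕ∞ :=
  if piIdx ε i = ⊤ then ⊤
  else
    min
      (sInf ((fun m : ℕ => (m : ℕ∞)) ''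
        {j : ℕ | (piIdx ε i).toNat ≤ j ∧
          dminDef γ₂ ω₁ C L (ε (piIdx ε i).toNat) ≤ ‖d j‖}))
      (piIdx ε (i+1))

section CATTrajectory

variable {n : ℕ} {θ β ω₁ ω₂ γ₁ γ₂ γ₃ ξ L Δf : ℝ}
  {f : EuclideanSpace ℝ (Fin n) → ℝ}
  {x d : ℕ → EuclideanSpace ℝ (Fin n)} {r δ ε : ℕ → ℝ} {b : ℕ → EReal}

namespace CATTraj

lemma eps_succ_le (traj : CATTraj θ β ω₁ ω₂ γ₁ γ₂ γ₃ ξ f x d r δ ε b) {k : ℕ} (hk : 1 ≤ k) :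
    ε (k + 1) ≤ ε k := by
  by_cases h : (f (x k + d k) : EReal) ≤ (f (x k) : EReal) + b k
  · rw [traj.eps_succ_dec k hk h]
    exact min_le_left _ _
  · exact (traj.eps_succ_keep k hk h).le

lemma eps_anti (traj : CATTraj θ β ω₁ ω₂ γ₁ γ₂ γ₃ ξ f x d r δ ε b) {j k : ℕ} (hj : 1 ≤ j)
    (hjk : j ≤ k) : ε k ≤ ε j := by
  induction k, hjk using Nat.le_induction with
  | base => exact le_rfl
  | succ k hk ih => exact (traj.eps_succ_le (hj.trans hk)).trans ih

lemma f_succ_le (traj : CATTraj θ β ω₁ ω₂ γ₁ γ₂ γ₃ ξ f x d r δ ε b) {k : ℕ} (hk : 1 ≤ k) :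
    f (x (k + 1)) ≤ f (x k) := by
  by_cases h : f (x k + d k) ≤ f (x k)
  · rwa [traj.step_acc k hk h]
  · rw [traj.step_rej k hk h]

lemma f_anti (traj : CATTraj θ β ω₁ ω₂ γ₁ γ₂ γ₃ ξ f x d r δ ε b) {j k : ℕ} (hj : 1 ≤ j)
    (hjk : j ≤ k) : f (x k) ≤ f (x j) := by
  induction k, hjk using Nat.le_induction with
  | base => exact le_rfl
  | succ k hk ih => exact (traj.f_succ_le (hj.trans hk)).trans ih

lemma le_add_b_of_le (traj : CATTraj θ β ω₁ ω₂ γ₁ γ₂ γ₃ ξ f x d r δ ε b) {k : ℕ} (hk : 1 ≤ k)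
    (h : f (x k + d k) ≤ f (x k)) :
    (f (x k + d k) : EReal) ≤ (f (x k) : EReal) + b k := by
  have h1 : (f (x k + d k) : EReal) ≤ (f (x k) : EReal) := by exact_mod_cast h
  exact h1.trans (le_add_of_nonneg_right (traj.b_pos k hk).le)

lemma eps_le_grad (traj : CATTraj θ β ω₁ ω₂ γ₁ γ₂ γ₃ ξ f x d r δ ε b) {k : ℕ} (hk : 1 ≤ k) :
    ε k ≤ ‖gradient f (x k)‖ := by
  induction k, hk using Nat.le_induction with
  | base => exact traj.eps_one.le
  | succ k hk ih =>
    by_cases h : f (x k + d k) ≤ f (x k)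
    · rw [traj.step_acc k hk h, traj.eps_succ_dec k hk (traj.le_add_b_of_le hk h)]
      exact min_le_right _ _
    · rw [traj.step_rej k hk h]
      exact (traj.eps_succ_le hk).trans ih

lemma modelVal_nonpos (traj : CATTraj θ β ω₁ ω₂ γ₁ γ₂ γ₃ ξ f x d r δ ε b) (hγ₃ : 0 < γ₃)
    {k : ℕ} (hk : 1 ≤ k) : modelVal f (x k) (d k) ≤ 0 := by
  have h1 := traj.sub_decr k hk
  have h2 : 0 ≤ γ₃ * (δ k / 2) * ‖d k‖ ^ 2 := by
    have := traj.δ_nonneg k hk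
    positivity
  linarith

lemma success_mul_le (traj : CATTraj θ β ω₁ ω₂ γ₁ γ₂ γ₃ ξ f x d r δ ε b) (hθ : 0 < θ)
    (hβ : 0 < β) (hγ₃ : 0 < γ₃) {k : ℕ} (hk : 1 ≤ k)
    (hs : β ≤ rhoHat θ f (x k) (d k)) :
    β * (-(modelVal f (x k) (d k)) +
      (θ/2) * min ‖gradient f (x k)‖ ‖gradient f (x k + d k)‖ * ‖d k‖) ≤
      f (x k) - f (x k + d k) := by
  have hM := traj.modelVal_nonpos hγ₃ hk
  have hm : 0 ≤ (θ/2) * min ‖gradient f (x k)‖ ‖gradient f (x k + d k)‖ * ‖d k‖ := by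
    positivity
  unfold rhoHat at hs
  rcases (by linarith : 0 ≤ -(modelVal f (x k) (d k)) +
      (θ/2) * min ‖gradient f (x k)‖ ‖gradient f (x k + d k)‖ * ‖d k‖).eq_or_lt with h | h
  · rw [← h, div_zero] at hs
    linarith
  · rwa [le_div_iff₀ h] at hs

lemma success_le (traj : CATTraj θ β ω₁ ω₂ γ₁ γ₂ γ₃ ξ f x d r δ ε b) (hθ : 0 < θ)
    (hβ : 0 < β) (hγ₃ : 0 < γ₃) {k : ℕ} (hk : 1 ≤ k)
    (hs : β ≤ rhoHat θ f (x k) (d k)) : f (x k + d k) ≤ f (x k) := by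
  have h := traj.success_mul_le hθ hβ hγ₃ hk hs
  have hM := traj.modelVal_nonpos hγ₃ hk
  have hm : 0 ≤ (θ/2) * min ‖gradient f (x k)‖ ‖gradient f (x k + d k)‖ * ‖d k‖ := by
    positivity
  have := mul_nonneg hβ.le (add_nonneg (neg_nonneg.2 hM) hm)
  linarith

/-- Successful iterations decrease `f` by at least a multiple of `ε_{k+1} ‖d_k‖`. -/
lemma success_decrease (traj : CATTraj θ β ω₁ ω₂ γ₁ γ₂ γ₃ ξ f x d r δ ε b) (hθ : 0 < θ)
    (hβ : 0 < β) (hγ₃ : 0 < γ₃) {k : ℕ} (hk : 1 ≤ k)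
    (hs : β ≤ rhoHat θ f (x k) (d k)) :
    β * θ / 2 * ε (k + 1) * ‖d k‖ ≤ f (x k) - f (x (k + 1)) := by
  have h := traj.success_mul_le hθ hβ hγ₃ hk hs
  have hle := traj.success_le hθ hβ hγ₃ hk hs
  have hM := traj.modelVal_nonpos hγ₃ hk
  have he : ε (k + 1) ≤ min ‖gradient f (x k)‖ ‖gradient f (x k + d k)‖ := by
    rw [traj.eps_succ_dec k hk (traj.le_add_b_of_le hk hle)]
    exact min_le_min_right _ (traj.eps_le_grad hk)
  rw [traj.step_acc k hk hle]
  refine le_trans ?_ h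
  have h1 : β * θ / 2 * ε (k + 1) * ‖d k‖ ≤
      β * θ / 2 * min ‖gradient f (x k)‖ ‖gradient f (x k + d k)‖ * ‖d k‖ := by gcongr
  nlinarith [mul_nonneg hβ.le (neg_nonneg.2 hM)]

/-- On unsuccessful iterations the actual reduction is at most `β` times the predicted one,
including when the predicted reduction vanishes. -/
lemma fail_le (traj : CATTraj θ β ω₁ ω₂ γ₁ γ₂ γ₃ ξ f x d r δ ε b) (hθ : 0 < θ)
    (hγ₃ : 0 < γ₃) {k : ℕ} (hk : 1 ≤ k)
    (hs : ¬ β ≤ rhoHat θ f (x k) (d k)) :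
    f (x k) - f (x k + d k) ≤ β * (-(modelVal f (x k) (d k)) +
      (θ/2) * min ‖gradient f (x k)‖ ‖gradient f (x k + d k)‖ * ‖d k‖) := by
  have hM := traj.modelVal_nonpos hγ₃ hk
  have hm : 0 ≤ (θ/2) * min ‖gradient f (x k)‖ ‖gradient f (x k + d k)‖ * ‖d k‖ := by
    positivity
  unfold rhoHat at hs
  rcases (by linarith : 0 ≤ -(modelVal f (x k) (d k)) +
      (θ/2) * min ‖gradient f (x k)‖ ‖gradient f (x k + d k)‖ * ‖d k‖).eq_or_lt with h | h
  · rw [← h, mul_zero]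
    by_contra! hlt
    have hle : f (x k + d k) ≤ f (x k) := by linarith
    have h0 : (θ/2) * min ‖gradient f (x k)‖ ‖gradient f (x k + d k)‖ * ‖d k‖ = 0 := by
      linarith
    have he := traj.eps_succ_dec k hk (traj.le_add_b_of_le hk hle)
    have hp : 0 < min ‖gradient f (x k)‖ ‖gradient f (x k + d k)‖ := by
      have h1 := traj.ε_pos (k + 1) (by omega)
      have h2 := traj.eps_le_grad hk
      rw [he] at h1
      exact h1.trans_le (min_le_min_right _ h2)
    have hd : d k = 0 := by
      rcases mul_eq_zero.1 h0 with h1 | h1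
      · exact absurd h1 (by positivity)
      · exact norm_eq_zero.1 h1
    rw [hd, add_zero, sub_self] at hlt
    exact lt_irrefl _ hlt
  · rw [not_le, div_lt_iff₀ h] at hs
    exact hs.le

lemma norm_grad_le (traj : CATTraj θ β ω₁ ω₂ γ₁ γ₂ γ₃ ξ f x d r δ ε b)
    (hA : Assumption1 L Δf f x d) {k : ℕ} (hk : 1 ≤ k) :
    ‖gradient f (x k + d k)‖ ≤ γ₁ * ε k + δ k * ‖d k‖ + (L/2) * ‖d k‖ ^ 2 := by
  have h1 := (hA k hk).2.1
  have h2 := traj.sub_grad k hk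
  have h3 : ‖gradModel f (x k) (d k)‖ ≤
      ‖gradModel f (x k) (d k) + δ k • d k‖ + ‖δ k • d k‖ := by
    simpa using norm_sub_le (gradModel f (x k) (d k) + δ k • d k) (δ k • d k)
  rw [norm_smul, Real.norm_of_nonneg (traj.δ_nonneg k hk)] at h3
  linarith

/-- On unsuccessful iterations, `δ_k ‖d_k‖` is controlled. -/
lemma fail_delta_le (traj : CATTraj θ β ω₁ ω₂ γ₁ γ₂ γ₃ ξ f x d r δ ε b) (hθ : 0 < θ)
    (hβ : 0 < β ∧ β < 1) (hγ₃ : 0 < γ₃) (hA : Assumption1 L Δf f x d)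
    {k : ℕ} (hk : 1 ≤ k) (hs : ¬ β ≤ rhoHat θ f (x k) (d k)) :
    γ₃ * (1 - β) * (δ k * ‖d k‖) ≤
      L / 3 * ‖d k‖ ^ 2 + β * θ * ‖gradient f (x k + d k)‖ := by
  rcases (norm_nonneg (d k)).eq_or_lt with h0 | h0
  · rw [← h0]
    have := mul_nonneg (mul_pos hβ.1 hθ).le (norm_nonneg (gradient f (x k + d k)))
    nlinarith
  · have h1 := traj.fail_le hθ hγ₃ hk hs
    have h2 := (hA k hk).2.2
    have h3 := traj.sub_decr k hk
    have h4 : (θ/2) * min ‖gradient f (x k)‖ ‖gradient f (x k + d k)‖ * ‖d k‖ ≤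
        (θ/2) * ‖gradient f (x k + d k)‖ * ‖d k‖ := by
      gcongr
      exact min_le_right _ _
    have h5 := mul_le_mul_of_nonneg_left h4 hβ.1.le
    have h6 := mul_le_mul_of_nonneg_left h3 (sub_pos.2 hβ.2).le
    refine le_of_mul_le_mul_right ?_ h0
    nlinarith

end CATTraj

lemma coeff_pos (hβ : 0 < β ∧ β < 1) (hγ₃ : 0 < γ₃)
    (hγ₁ : 0 ≤ γ₁ ∧ γ₁ < (1/2) * (1 - β * θ / (γ₃ * (1 - β)))) :
    0 < γ₃ * (1 - β) - β * θ ∧ 0 < 1 - 2 * γ₁ * c2Def θ β γ₃ := by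
  have ha : 0 < γ₃ * (1 - β) := mul_pos hγ₃ (sub_pos.2 hβ.2)
  have hlt : β * θ / (γ₃ * (1 - β)) < 1 := by linarith
  have hq : 0 < γ₃ * (1 - β) - β * θ := by
    rw [div_lt_one ha] at hlt
    linarith
  refine ⟨hq, ?_⟩
  have h1 : 2 * γ₁ * (γ₃ * (1 - β)) < γ₃ * (1 - β) - β * θ := by
    have h2 := mul_lt_mul_of_pos_right hγ₁.2 ha
    have h3 : (1/2) * (1 - β * θ / (γ₃ * (1 - β))) * (γ₃ * (1 - β)) =
      (1/2) * (γ₃ * (1 - β) - β * θ) := by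
      rw [mul_assoc, sub_mul, one_mul, div_mul_cancel₀ _ ha.ne']
    linarith
  have h2 : 2 * γ₁ * c2Def θ β γ₃ < 1 := by
    unfold c2Def
    rw [← mul_div_assoc, div_lt_one hq]
    exact h1
  linarith

lemma CDef_pos (hξ : 0 < ξ) : 0 < CDef θ β γ₃ γ₁ ξ :=
  lt_of_lt_of_le (by positivity : 0 < 1 / (3 * ξ)) (le_max_left _ _)

/-- An upper bound `g ≤ c₂ γ₁ E + c₁ L s²` with `E/2 ≤ g` forces `E ≤ C L s²`. -/
lemma le_CDef_mul (hβ : 0 < β ∧ β < 1) (hγ₃ : 0 < γ₃)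
    (hγ₁ : 0 ≤ γ₁ ∧ γ₁ < (1/2) * (1 - β * θ / (γ₃ * (1 - β)))) (hL : 0 < L) {E g s : ℝ}
    (hg : E / 2 ≤ g)
    (h : (γ₃ * (1 - β) - β * θ) * g ≤
      γ₃ * (1 - β) * γ₁ * E + (2 + 3 * γ₃ * (1 - β)) / 6 * (L * s ^ 2)) :
    E ≤ CDef θ β γ₃ γ₁ ξ * L * s ^ 2 := by
  obtain ⟨hq, hc⟩ := coeff_pos hβ hγ₃ hγ₁
  have h1 : g ≤ c2Def θ β γ₃ * γ₁ * E + c1Def θ β γ₃ * (L * s ^ 2) := by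
    refine le_of_mul_le_mul_left (h.trans_eq ?_) hq
    unfold c1Def c2Def
    field_simp
  have h2 : (1 - 2 * γ₁ * c2Def θ β γ₃) * E ≤ 2 * c1Def θ β γ₃ * (L * s ^ 2) := by
    nlinarith
  have h3 : E ≤ 2 * c1Def θ β γ₃ / (1 - 2 * γ₁ * c2Def θ β γ₃) * (L * s ^ 2) := by
    rw [div_mul_eq_mul_div, le_div_iff₀ hc]
    linarith
  refine h3.trans ?_
  rw [mul_assoc (CDef θ β γ₃ γ₁ ξ)]
  exact mul_le_mul_of_nonneg_right (le_max_right _ _) (by positivity)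

lemma dminDef_mul_le {C E s : ℝ} (hω₁ : 1 < ω₁) (hγ₂ : 0 < γ₂) (hC : 0 < C) (hL : 0 < L)
    (hs : 0 ≤ s) (h : E ≤ C * L * s ^ 2) : ω₁ * dminDef γ₂ ω₁ C L E ≤ γ₂ * s := by
  have h1 : √E ≤ √C * √L * s := by
    rw [← Real.sqrt_mul hC.le]
    calc √E ≤ √(C * L * s ^ 2) := Real.sqrt_le_sqrt h
      _ = √(C * L) * s := by rw [Real.sqrt_mul (by positivity), Real.sqrt_sq hs]
  have hC' := Real.sqrt_pos.2 hC
  have hL' := Real.sqrt_pos.2 hL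
  unfold dminDef
  calc ω₁ * (γ₂ * ω₁⁻¹ * (√C)⁻¹ * (√L)⁻¹ * √E)
      ≤ ω₁ * (γ₂ * ω₁⁻¹ * (√C)⁻¹ * (√L)⁻¹ * (√C * √L * s)) := by gcongr
    _ = γ₂ * s := by field_simp

lemma dminDef_pos {C E : ℝ} (hω₁ : 1 < ω₁) (hγ₂ : 0 < γ₂) (hC : 0 < C) (hL : 0 < L)
    (hE : 0 < E) : 0 < dminDef γ₂ ω₁ C L E := by
  unfold dminDef
  positivity

namespace CATTraj

lemma fail_le_norm_sq (traj : CATTraj θ β ω₁ ω₂ γ₁ γ₂ γ₃ ξ f x d r δ ε b) (hθ : 0 < θ)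
    (hβ : 0 < β ∧ β < 1) (hγ₃ : 0 < γ₃)
    (hγ₁ : 0 ≤ γ₁ ∧ γ₁ < (1/2) * (1 - β * θ / (γ₃ * (1 - β)))) (hξ : 0 < ξ)
    (hL : 0 < L) (hA : Assumption1 L Δf f x d) {k : ℕ} (hk : 1 ≤ k) {E : ℝ}
    (hkE : ε k ≤ E) (hE : E / 2 ≤ ε (k + 1)) (hs : ¬ β ≤ rhoHat θ f (x k) (d k)) :
    E ≤ CDef θ β γ₃ γ₁ ξ * L * ‖d k‖ ^ 2 := by
  by_cases hb : (f (x k + d k) : EReal) ≤ (f (x k) : EReal) + b k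
  · have he := traj.eps_succ_dec k hk hb
    have hg : E / 2 ≤ ‖gradient f (x k + d k)‖ :=
      hE.trans (he.le.trans (min_le_right _ _))
    refine le_CDef_mul hβ hγ₃ hγ₁ hL hg ?_
    have ha : 0 < γ₃ * (1 - β) := mul_pos hγ₃ (sub_pos.2 hβ.2)
    have h1 := mul_le_mul_of_nonneg_left (traj.norm_grad_le hA hk) ha.le
    have h2 := traj.fail_delta_le hθ hβ hγ₃ hA hk hs
    have h3 := mul_le_mul_of_nonneg_left hkE (mul_nonneg ha.le hγ₁.1)
    nlinarith
  · have h1 : ((f (x k) + ξ * ε k * ‖d k‖ : ℝ) : EReal) < (f (x k + d k) : EReal) := by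
      push_cast
      refine lt_of_le_of_lt ?_ (not_le.1 hb)
      have := traj.b_lb k hk
      push_cast at this
      gcongr
    have h2 : f (x k) + ξ * ε k * ‖d k‖ < f (x k + d k) := by exact_mod_cast h1
    have h0 : 0 < ‖d k‖ := by
      rcases (norm_nonneg (d k)).eq_or_lt with h0 | h0
      · rw [norm_eq_zero.1 h0.symm] at h2
        simp at h2
      · exact h0
    have h3 := (hA k hk).2.2
    have h4 := traj.modelVal_nonpos hγ₃ hk
    have h5 : ξ * ε k ≤ L / 6 * ‖d k‖ ^ 2 := by
      refine le_of_mul_le_mul_right ?_ h0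
      nlinarith
    have h6 : E / 2 ≤ ε k := hE.trans (traj.eps_succ_le hk)
    have h7 : E ≤ 1 / (3 * ξ) * (L * ‖d k‖ ^ 2) := by
      rw [div_mul_eq_mul_div, le_div_iff₀ (by positivity)]
      nlinarith
    refine h7.trans ?_
    rw [mul_assoc]
    gcongr
    exact le_max_left _ _

lemma delta_zero_le_norm_sq (traj : CATTraj θ β ω₁ ω₂ γ₁ γ₂ γ₃ ξ f x d r δ ε b) (hθ : 0 < θ)
    (hβ : 0 < β ∧ β < 1) (hγ₃ : 0 < γ₃)
    (hγ₁ : 0 ≤ γ₁ ∧ γ₁ < (1/2) * (1 - β * θ / (γ₃ * (1 - β))))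
    (hL : 0 < L) (hA : Assumption1 L Δf f x d) {k : ℕ} (hk : 1 ≤ k) {E : ℝ}
    (hkE : ε k ≤ E) (hE : E / 2 ≤ ε (k + 1)) (hs : β ≤ rhoHat θ f (x k) (d k))
    (hδ : δ k = 0) :
    E ≤ CDef θ β γ₃ γ₁ ξ * L * ‖d k‖ ^ 2 := by
  have hle := traj.success_le hθ hβ.1 hγ₃ hk hs
  have he := traj.eps_succ_dec k hk (traj.le_add_b_of_le hk hle)
  have hg : E / 2 ≤ ‖gradient f (x k + d k)‖ :=
    hE.trans (he.le.trans (min_le_right _ _))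
  refine le_CDef_mul hβ hγ₃ hγ₁ hL hg ?_
  have ha : 0 < γ₃ * (1 - β) := mul_pos hγ₃ (sub_pos.2 hβ.2)
  have h1 := traj.norm_grad_le hA hk
  rw [hδ, zero_mul, add_zero] at h1
  have h2 := mul_le_mul_of_nonneg_left h1 ha.le
  have h3 := mul_le_mul_of_nonneg_left hkE (mul_nonneg ha.le hγ₁.1)
  have h4 : 0 ≤ β * θ * ‖gradient f (x k + d k)‖ :=
    mul_nonneg (mul_pos hβ.1 hθ).le (norm_nonneg _)
  have h5 : 0 ≤ L * ‖d k‖ ^ 2 := by positivity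
  nlinarith

/-- Once a step is at least `d_min` long, so are the steps and radii that follow, as long as
`ε` has not been halved. -/
lemma dmin_le_norm (traj : CATTraj θ β ω₁ ω₂ γ₁ γ₂ γ₃ ξ f x d r δ ε b) (hθ : 0 < θ)
    (hβ : 0 < β ∧ β < 1) (hω₁ : 1 < ω₁) (hω₂ : ω₁ ≤ ω₂) (hγ₃ : 0 < γ₃)
    (hγ₂ : ω₁⁻¹ < γ₂ ∧ γ₂ ≤ 1)
    (hγ₁ : 0 ≤ γ₁ ∧ γ₁ < (1/2) * (1 - β * θ / (γ₃ * (1 - β)))) (hξ : 0 < ξ)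
    (hL : 0 < L) (hA : Assumption1 L Δf f x d) {p T t : ℕ} (hp : 1 ≤ p) (hpT : p ≤ T)
    (hT : dminDef γ₂ ω₁ (CDef θ β γ₃ γ₁ ξ) L (ε p) ≤ ‖d T‖) (hTt : T ≤ t)
    (hE : ∀ k, 1 ≤ k → k ≤ t + 1 → ε p / 2 ≤ ε k) :
    dminDef γ₂ ω₁ (CDef θ β γ₃ γ₁ ξ) L (ε p) ≤ ‖d t‖ := by
  have hγ : 0 < γ₂ := (inv_pos.2 (by linarith)).trans hγ₂.1
  have hC : 0 < CDef θ β γ₃ γ₁ ξ := CDef_pos hξ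
  have hD := dminDef_pos hω₁ hγ hC hL (traj.ε_pos p hp)
  have hstep {k : ℕ} (h : ε p ≤ CDef θ β γ₃ γ₁ ξ * L * ‖d k‖ ^ 2) :=
    dminDef_mul_le hω₁ hγ hC hL (norm_nonneg (d k)) h
  set D := dminDef γ₂ ω₁ (CDef θ β γ₃ γ₁ ξ) L (ε p)
  have hlong {k : ℕ} (h : ω₁ * D ≤ γ₂ * ‖d k‖) : D ≤ ‖d k‖ := by
    nlinarith [norm_nonneg (d k)]
  induction t, hTt using Nat.le_induction with
  | base => exact hT
  | succ t hTt ih =>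
    have ih := ih fun k h1 h2 => hE k h1 (by omega)
    have ht : 1 ≤ t := by omega
    have hr : D ≤ γ₂ * r (t + 1) := by
      by_cases hs : β ≤ rhoHat θ f (x t) (d t)
      · rw [traj.radius_succ t ht hs]
        have h1 : 1 ≤ γ₂ * ω₂ := by
          have h2 : 1 < γ₂ * ω₁ := by
            rw [← inv_lt_iff_one_lt_mul₀ (by linarith)]
            exact hγ₂.1
          nlinarith
        calc D ≤ (γ₂ * ω₂) * ‖d t‖ := by nlinarith
          _ = γ₂ * (ω₂ * ‖d t‖) := by ring
          _ ≤ γ₂ * max (ω₂ * ‖d t‖) (r t) := by gcongr; exact le_max_left _ _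
      · rw [traj.radius_fail t ht hs]
        have h1 := hstep (traj.fail_le_norm_sq hθ hβ hγ₃ hγ₁ hξ hL hA ht
          (traj.eps_anti hp (by omega)) (hE _ (by omega) (by omega)) hs)
        have h2 := mul_le_mul_of_nonneg_left (traj.sub_rad t ht) hγ.le
        rw [← mul_div_assoc, le_div_iff₀ (by linarith)]
        linarith
    have ht' : 1 ≤ t + 1 := by omega
    by_cases hs : β ≤ rhoHat θ f (x (t + 1)) (d (t + 1))
    · rcases (traj.δ_nonneg _ ht').eq_or_lt with h0 | h0
      · exact hlong (hstep (traj.delta_zero_le_norm_sq hθ hβ hγ₃ hγ₁ hL hA ht'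
          (traj.eps_anti hp (by omega)) (hE _ (by omega) (by omega)) hs h0.symm))
      · refine hr.trans (le_of_mul_le_mul_left ?_ h0)
        have := traj.sub_comp _ ht'
        linarith
    · exact hlong (hstep (traj.fail_le_norm_sq hθ hβ hγ₃ hγ₁ hξ hL hA ht'
          (traj.eps_anti hp (by omega)) (hE _ (by omega) (by omega)) hs))

lemma radius_le (traj : CATTraj θ β ω₁ ω₂ γ₁ γ₂ γ₃ ξ f x d r δ ε b) (hθ : 0 < θ)
    (hβ : 0 < β) (hω₁ : 1 < ω₁) (hω₂ : ω₁ ≤ ω₂) (hγ₃ : 0 < γ₃)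
    (hA : Assumption1 L Δf f x d) {k : ℕ} (hk : 1 ≤ k) {E : ℝ} (hE : 0 < E)
    (hEk : ∀ j, 1 ≤ j → j ≤ k → E / 2 ≤ ε j) :
    r k ≤ max (r 1) (2 * dmaxDef ω₂ β θ Δf E) := by
  induction k, hk using Nat.le_induction with
  | base => exact le_max_left _ _
  | succ k hk ih =>
    have ih := ih fun j h1 h2 => hEk j h1 (by omega)
    by_cases hs : β ≤ rhoHat θ f (x k) (d k)
    · rw [traj.radius_succ k hk hs]
      refine max_le (le_max_of_le_right ?_) ih
      have h1 := traj.success_decrease hθ hβ hγ₃ hk hs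
      have h2 := (hA (k + 1) (by omega)).1
      have h3 := traj.f_anti le_rfl hk
      have h4 : β * θ / 2 * (E / 2) * ‖d k‖ ≤ β * θ / 2 * ε (k + 1) * ‖d k‖ := by
        gcongr
        exact hEk _ (by omega) le_rfl
      have h5 : ‖d k‖ ≤ 4 * Δf / (β * θ * E) := by
        rw [le_div_iff₀ (by positivity)]
        linarith
      have hω : 0 < ω₂ := by linarith
      calc ω₂ * ‖d k‖ ≤ ω₂ * (4 * Δf / (β * θ * E)) := by gcongr
        _ = 2 * dmaxDef ω₂ β θ Δf E := by
          unfold dmaxDef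
          field_simp
          ring
    · rw [traj.radius_fail k hk hs]
      exact (div_le_self (traj.r_pos k hk).le hω₁.le).trans ih

/-- Splitting iterations `T, …, t - 1` into `S` successful and `F` unsuccessful ones. -/
lemma exists_count (traj : CATTraj θ β ω₁ ω₂ γ₁ γ₂ γ₃ ξ f x d r δ ε b) (hθ : 0 < θ)
    (hβ : 0 < β) (hω₁ : 1 < ω₁) (hω₂ : ω₁ ≤ ω₂) (hγ₃ : 0 < γ₃) {T t : ℕ} (hT : 1 ≤ T)
    (hTt : T ≤ t) {E D : ℝ} (hD : 0 < D)
    (hEk : ∀ k, T ≤ k → k ≤ t → E / 2 ≤ ε k) (hDk : ∀ k, T ≤ k → k ≤ t → D ≤ ‖d k‖) :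
    ∃ S F : ℕ, T + S + F = t ∧ r t * ω₁ ^ F ≤ r T * ω₂ ^ S ∧
      S * (β * θ * E * D / 4) ≤ f (x T) - f (x t) := by
  induction t, hTt using Nat.le_induction with
  | base => exact ⟨0, 0, by simp⟩
  | succ t hTt ih =>
    obtain ⟨S, F, hSF, hr, hf⟩ :=
      ih (fun k h1 h2 => hEk k h1 (by omega)) (fun k h1 h2 => hDk k h1 (by omega))
    have ht : 1 ≤ t := hT.trans hTt
    by_cases hs : β ≤ rhoHat θ f (x t) (d t)
    · refine ⟨S + 1, F, by omega, ?_, ?_⟩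
      · have hω : 1 ≤ ω₂ := by linarith
        have h1 : r (t + 1) ≤ ω₂ * r t := by
          rw [traj.radius_succ t ht hs]
          refine max_le ?_ (le_mul_of_one_le_left (traj.r_pos t ht).le hω)
          gcongr
          exact traj.sub_rad t ht
        calc r (t + 1) * ω₁ ^ F ≤ ω₂ * r t * ω₁ ^ F := by gcongr
          _ = ω₂ * (r t * ω₁ ^ F) := by ring
          _ ≤ ω₂ * (r T * ω₂ ^ S) := by gcongr
          _ = r T * ω₂ ^ (S + 1) := by ring
      · have h1 := traj.success_decrease hθ hβ hγ₃ ht hs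
        have h2 : β * θ / 2 * (E / 2) * D ≤ β * θ / 2 * ε (t + 1) * ‖d t‖ := by
          have := hEk (t + 1) (by omega) le_rfl
          have := hDk t hTt (by omega)
          have := traj.ε_pos (t + 1) (by omega)
          gcongr
        push_cast
        linarith
    · refine ⟨S, F + 1, by omega, ?_, ?_⟩
      · rw [traj.radius_fail t ht hs]
        calc r t / ω₁ * ω₁ ^ (F + 1) = r t * ω₁ ^ F := by
              rw [pow_succ]
              field_simp
          _ ≤ _ := hr
      · linarith [traj.f_succ_le ht]

lemma phase_length_le (traj : CATTraj θ β ω₁ ω₂ γ₁ γ₂ γ₃ ξ f x d r δ ε b) (hθ : 0 < θ)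
    (hβ : 0 < β ∧ β < 1) (hω₁ : 1 < ω₁) (hω₂ : ω₁ ≤ ω₂) (hγ₃ : 0 < γ₃)
    (hγ₂ : ω₁⁻¹ < γ₂ ∧ γ₂ ≤ 1)
    (hγ₁ : 0 ≤ γ₁ ∧ γ₁ < (1/2) * (1 - β * θ / (γ₃ * (1 - β)))) (hξ : 0 < ξ)
    (hL : 0 < L) (hA : Assumption1 L Δf f x d) {p T t : ℕ} (hp : 1 ≤ p) (hpT : p ≤ T)
    (hT : dminDef γ₂ ω₁ (CDef θ β γ₃ γ₁ ξ) L (ε p) ≤ ‖d T‖) (hTt : T ≤ t)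
    (hE : ∀ k, 1 ≤ k → k ≤ t + 1 → ε p / 2 ≤ ε k) :
    (t : ℝ) + 2 - T ≤
      Real.logb ω₁ (ω₂ ^ 3 * max (r 1) (2 * dmaxDef ω₂ β θ Δf (ε p)) /
        dminDef γ₂ ω₁ (CDef θ β γ₃ γ₁ ξ) L (ε p)) +
      4 * Real.logb ω₁ (ω₁ * ω₂) * ((f (x p) - f (x t)) /
        (β * θ * ε p * dminDef γ₂ ω₁ (CDef θ β γ₃ γ₁ ξ) L (ε p))) := by
  have hγ : 0 < γ₂ := (inv_pos.2 (by linarith)).trans hγ₂.1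
  have hεp := traj.ε_pos p hp
  have hD := dminDef_pos hω₁ hγ (CDef_pos (θ := θ) (β := β) (γ₃ := γ₃) (γ₁ := γ₁) hξ) hL hεp
  have hDk : ∀ k, T ≤ k → k ≤ t → dminDef γ₂ ω₁ (CDef θ β γ₃ γ₁ ξ) L (ε p) ≤ ‖d k‖ :=
    fun k h1 h2 => traj.dmin_le_norm hθ hβ hω₁ hω₂ hγ₃ hγ₂ hγ₁ hξ hL hA hp hpT hT h1
      fun j h3 h4 => hE j h3 (by omega)
  set D := dminDef γ₂ ω₁ (CDef θ β γ₃ γ₁ ξ) L (ε p)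
  have hrT : r T ≤ max (r 1) (2 * dmaxDef ω₂ β θ Δf (ε p)) :=
    traj.radius_le hθ hβ.1 hω₁ hω₂ hγ₃ hA (hp.trans hpT) hεp fun j h1 h2 => hE j h1 (by omega)
  set R := max (r 1) (2 * dmaxDef ω₂ β θ Δf (ε p))
  have hR : 0 < R := (traj.r_pos 1 le_rfl).trans_le (le_max_left _ _)
  obtain ⟨S, F, hSF, hr, hf⟩ := traj.exists_count hθ hβ.1 hω₁ hω₂ hγ₃ (hp.trans hpT) hTt hD
    (fun k h1 h2 => hE k (by omega) (by omega)) hDk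
  have hDr : D ≤ r t := (hDk t hTt le_rfl).trans (traj.sub_rad t (by omega))
  have hω₁0 : 0 < ω₁ := by linarith
  have hω₂0 : 0 < ω₂ := by linarith
  have hpow : ω₁ ^ (S + F + 2) ≤ ω₂ ^ 3 * R / D * (ω₁ * ω₂) ^ S := by
    rw [div_mul_eq_mul_div, le_div_iff₀ hD]
    have h1 : D * ω₁ ^ F ≤ R * ω₂ ^ S :=
      calc D * ω₁ ^ F ≤ r t * ω₁ ^ F := by gcongr
        _ ≤ r T * ω₂ ^ S := hr
        _ ≤ R * ω₂ ^ S := by gcongr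
    have h2 : ω₁ ^ 2 ≤ ω₂ ^ 3 := by
      calc ω₁ ^ 2 ≤ ω₂ ^ 2 := by gcongr
        _ ≤ ω₂ ^ 3 := pow_le_pow_right₀ (by linarith) (by norm_num)
    calc ω₁ ^ (S + F + 2) * D = ω₁ ^ 2 * ω₁ ^ S * (D * ω₁ ^ F) := by ring
      _ ≤ ω₂ ^ 3 * ω₁ ^ S * (R * ω₂ ^ S) := by gcongr
      _ = ω₂ ^ 3 * R * (ω₁ * ω₂) ^ S := by rw [mul_pow]; ring
  have hlog := Real.logb_le_logb_of_le hω₁ (by positivity) hpow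
  rw [Real.logb_mul (by positivity) (by positivity), Real.logb_pow, Real.logb_pow,
    Real.logb_self_eq_one hω₁] at hlog
  have hcast : (t : ℝ) = T + S + F := by exact_mod_cast hSF.symm
  have hlog0 : 0 ≤ Real.logb ω₁ (ω₁ * ω₂) :=
    Real.logb_nonneg hω₁ (by nlinarith)
  have hβ0 := hβ.1
  have hS : (S : ℝ) ≤ 4 * ((f (x p) - f (x t)) / (β * θ * ε p * D)) := by
    have h1 := traj.f_anti hp hpT
    rw [← mul_div_assoc, le_div_iff₀ (by positivity)]
    linarith
  have hfin := mul_le_mul_of_nonneg_left hS hlog0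
  push_cast at hlog
  linarith

end CATTraj

lemma le_eps_of_lt_piIdx {i p k : ℕ} (hi : 1 ≤ i) (hp : piIdx ε i = p) (hk : 1 ≤ k)
    (h : (k : ℕ∞) < piIdx ε (i + 1)) : ε p / 2 ≤ ε k := by
  obtain ⟨j, rfl⟩ : ∃ j, i = j + 1 := ⟨i - 1, by omega⟩
  rw [show piIdx ε (j + 1 + 1) = nextPi ε (piIdx ε (j + 1)) from rfl, hp, nextPi,
    if_neg (ENat.natCast_ne_top p)] at h
  by_contra! hlt
  exact not_le.2 h (sInf_le ⟨k, ⟨hk, by simpa using hlt⟩, rfl⟩)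

lemma one_le_piIdx (ε : ℕ → ℝ) (i : ℕ) : 1 ≤ piIdx ε i := by
  match i with
  | 0 => exact le_rfl
  | 1 => exact le_rfl
  | i + 2 =>
    rw [piIdx, nextPi]
    split_ifs
    · exact le_top
    · refine le_sInf ?_
      rintro _ ⟨m, hm, rfl⟩
      exact Nat.one_le_cast.2 hm.1

lemma tauIdx_spec {C : ℝ} {i p : ℕ} (hp : piIdx ε i = p)
    (h : tauIdx γ₂ ω₁ C L d ε i < piIdx ε (i + 1)) :
    ∃ T : ℕ, tauIdx γ₂ ω₁ C L d ε i = T ∧ p ≤ T ∧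
      dminDef γ₂ ω₁ C L (ε p) ≤ ‖d T‖ := by
  have htau : tauIdx γ₂ ω₁ C L d ε i = min (sInf ((fun m : ℕ => (m : ℕ∞)) ''
      {j : ℕ | p ≤ j ∧ dminDef γ₂ ω₁ C L (ε p) ≤ ‖d j‖})) (piIdx ε (i+1)) := by
    rw [tauIdx, hp, if_neg (ENat.natCast_ne_top p), ENat.toNat_natCast]
  rw [htau] at h ⊢
  have hlt := (min_lt_iff.1 h).resolve_right (lt_irrefl _)
  rw [min_eq_left hlt.le]
  have hne : ((fun m : ℕ => (m : ℕ∞)) ''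
      {j : ℕ | p ≤ j ∧ dminDef γ₂ ω₁ C L (ε p) ≤ ‖d j‖}).Nonempty := by
    by_contra hemp
    rw [Set.not_nonempty_iff_eq_empty.1 hemp, sInf_empty] at hlt
    exact absurd hlt not_top_lt
  obtain ⟨T, hT, hTe⟩ := csInf_mem hne
  exact ⟨T, hTe.symm, hT⟩

end CATTrajectory

/-- Lemma 4: bound on the length of phase two. -/
theorem phase_two_bound {n : ℕ} (hn : 1 ≤ n) (θ β ω₁ ω₂ γ₁ γ₂ γ₃ ξ L Δf : ℝ)
    (hθ : 0 < θ ∧ θ < 1) (hβ : 0 < β ∧ β < 1)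
    (hω₁ : 1 < ω₁) (hω₂ : ω₁ ≤ ω₂)
    (hγ₃ : 0 < γ₃ ∧ γ₃ ≤ 1) (hγ₂ : ω₁⁻¹ < γ₂ ∧ γ₂ ≤ 1)
    (hγ₁ : 0 ≤ γ₁ ∧ γ₁ < (1/2) * (1 - β * θ / (γ₃ * (1 - β))))
    (hξ : 0 < ξ)
    (f : EuclideanSpace ℝ (Fin n) → ℝ)
    (x d : ℕ → EuclideanSpace ℝ (Fin n)) (r δ ε : ℕ → ℝ) (b : ℕ → EReal)
    (traj : CATTraj θ β ω₁ ω₂ γ₁ γ₂ γ₃ ξ f x d r δ ε b)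
    (hL : 0 < L) (hΔf : 0 < Δf) (hA : Assumption1 L Δf f x d) :
    ∀ i : ℕ, 1 ≤ i → tauIdx γ₂ ω₁ (CDef θ β γ₃ γ₁ ξ) L d ε i ≠ ⊤ →
      piIdx ε (i+1) ≠ ⊤ ∧
      ∀ t : ℕ, tauIdx γ₂ ω₁ (CDef θ β γ₃ γ₁ ξ) L d ε i ≤ (t : ℕ∞) →
        ((t : ℕ∞) + 2 ≤ piIdx ε (i+1)) →
        (t : ℝ) + 2 - ((tauIdx γ₂ ω₁ (CDef θ β γ₃ γ₁ ξ) L d ε i).toNat : ℝ) ≤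
          Real.logb ω₁
            (ω₂ ^ 3 * max (r 1) (2 * dmaxDef ω₂ β θ Δf (ε (piIdx ε i).toNat)) /
              dminDef γ₂ ω₁ (CDef θ β γ₃ γ₁ ξ) L (ε (piIdx ε i).toNat)) +
          4 * Real.logb ω₁ (ω₁ * ω₂) *
            ((f (x (piIdx ε i).toNat) - f (x t)) /
              (β * θ * ε (piIdx ε i).toNat *
                dminDef γ₂ ω₁ (CDef θ β γ₃ γ₁ ξ) L (ε (piIdx ε i).toNat))) := by
  intro i hi hτ
  have hpne : piIdx ε i ≠ ⊤ := fun h => hτ (by rw [tauIdx, if_pos h])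
  obtain ⟨p, hp⟩ := ENat.ne_top_iff_exists.1 hpne
  replace hp := hp.symm
  have hp1 : 1 ≤ p := by
    have := one_le_piIdx ε i
    rw [hp] at this
    exact_mod_cast this
  rw [hp, ENat.toNat_natCast]
  have key : ∀ t : ℕ, tauIdx γ₂ ω₁ (CDef θ β γ₃ γ₁ ξ) L d ε i ≤ (t : ℕ∞) →
      ((t : ℕ∞) + 2 ≤ piIdx ε (i+1)) →
      (t : ℝ) + 2 - ((tauIdx γ₂ ω₁ (CDef θ β γ₃ γ₁ ξ) L d ε i).toNat : ℝ) ≤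
        Real.logb ω₁ (ω₂ ^ 3 * max (r 1) (2 * dmaxDef ω₂ β θ Δf (ε p)) /
          dminDef γ₂ ω₁ (CDef θ β γ₃ γ₁ ξ) L (ε p)) +
        4 * Real.logb ω₁ (ω₁ * ω₂) * ((f (x p) - f (x t)) /
          (β * θ * ε p * dminDef γ₂ ω₁ (CDef θ β γ₃ γ₁ ξ) L (ε p))) := by
    intro t ht ht2
    have hlt {k : ℕ} (hk : k ≤ t + 1) : (k : ℕ∞) < piIdx ε (i + 1) := by
      refine lt_of_lt_of_le ?_ ht2
      exact_mod_cast (by omega : k < t + 2)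
    obtain ⟨T, hT, hpT, hdT⟩ := tauIdx_spec hp (ht.trans_lt (hlt (Nat.le_succ t)))
    rw [hT] at ht ⊢
    rw [ENat.toNat_natCast]
    exact traj.phase_length_le hθ.1 hβ hω₁ hω₂ hγ₃.1 hγ₂ hγ₁ hξ hL hA hp1 hpT hdT
      (by exact_mod_cast ht) fun k h1 h2 => le_eps_of_lt_piIdx hi hp h1 (hlt h2)
  refine ⟨fun htop => ?_, key⟩
  obtain ⟨T, hT⟩ := ENat.ne_top_iff_exists.1 hτ
  have hγ : 0 < γ₂ := (inv_pos.2 (by linarith)).trans hγ₂.1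
  have hD := dminDef_pos hω₁ hγ (CDef_pos (θ := θ) (β := β) (γ₃ := γ₃) (γ₁ := γ₁) hξ) hL
    (traj.ε_pos p hp1)
  rw [← hT, ENat.toNat_natCast] at key
  set D := dminDef γ₂ ω₁ (CDef θ β γ₃ γ₁ ξ) L (ε p)
  set A := Real.logb ω₁ (ω₂ ^ 3 * max (r 1) (2 * dmaxDef ω₂ β θ Δf (ε p)) / D)
  obtain ⟨N, hN⟩ := exists_nat_gt
    (A + 4 * Real.logb ω₁ (ω₁ * ω₂) * (Δf / (β * θ * ε p * D)))
  have h1 := key (T + N + 1) (by exact_mod_cast (by omega : T ≤ T + N + 1)) (by simp [htop])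
  have h2 : f (x p) - f (x (T + N + 1)) ≤ Δf := by
    have h3 := (hA (T + N + 1) (by omega)).1
    have h4 := traj.f_anti le_rfl hp1
    linarith
  have h5 : 4 * Real.logb ω₁ (ω₁ * ω₂) * ((f (x p) - f (x (T + N + 1))) / (β * θ * ε p * D)) ≤
      4 * Real.logb ω₁ (ω₁ * ω₂) * (Δf / (β * θ * ε p * D)) := by
    have hlog0 : 0 ≤ Real.logb ω₁ (ω₁ * ω₂) := Real.logb_nonneg hω₁ (by nlinarith)
    have := hθ.1
    have := hβ.1
    have := traj.ε_pos p hp1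
    gcongr
  push_cast at h1
  linarith
end
end

section
/- Suppose σ ∈ (0, β] and a σ-CAT trajectory satisfies f(x₁) − f(x_k) ≤ Δ_f for all k (for some Δ_f ∈ (0,∞)). Then for every K ∈ ℕ: Δ_f ≥ (θσ/2)·ε_{K+1}·‖x_{K+1} − x₁‖. Consequently, if the iterates are unbounded (sup_k ‖x_k‖ = ∞), then lim_{K→∞} ε_K = 0. -/
open scoped RealInnerProductSpace
open Filter

noncomputable section

/-- A σ-CAT trajectory (Algorithm 1): as a CAT trajectory, but a step is accepted only
when additionally `ρ̂_k ≥ σ`. -/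
structure SigmaCATTraj {n : ℕ} (θ β ω₁ ω₂ γ₁ γ₂ γ₃ ξ σ : ℝ)
    (f : EuclideanSpace ℝ (Fin n) → ℝ)
    (x d : ℕ → EuclideanSpace ℝ (Fin n))
    (r δ ε : ℕ → ℝ) (b : ℕ → EReal) : Prop where
  hf : ∀ y, DifferentiableAt ℝ f y
  hf' : ∀ y, DifferentiableAt ℝ (gradient f) y
  r_pos : ∀ k, 1 ≤ k → 0 < r k
  δ_nonneg : ∀ k, 1 ≤ k → 0 ≤ δ k
  ε_pos : ∀ k, 1 ≤ k → 0 < ε k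
  b_pos : ∀ k, 1 ≤ k → 0 < b k
  sub_grad : ∀ k, 1 ≤ k → ‖gradModel f (x k) (d k) + δ k • d k‖ ≤ γ₁ * ε k
  sub_comp : ∀ k, 1 ≤ k → γ₂ * δ k * r k ≤ δ k * ‖d k‖
  sub_rad : ∀ k, 1 ≤ k → ‖d k‖ ≤ r k
  sub_decr : ∀ k, 1 ≤ k → modelVal f (x k) (d k) ≤ -(γ₃ * (δ k / 2) * ‖d k‖ ^ 2)
  step_acc : ∀ k, 1 ≤ k →
    (f (x k + d k) ≤ f (x k) ∧ σ ≤ rhoHat θ f (x k) (d k)) → x (k+1) = x k + d k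
  step_rej : ∀ k, 1 ≤ k →
    ¬ (f (x k + d k) ≤ f (x k) ∧ σ ≤ rhoHat θ f (x k) (d k)) → x (k+1) = x k
  radius_succ : ∀ k, 1 ≤ k → β ≤ rhoHat θ f (x k) (d k) →
    r (k+1) = max (ω₂ * ‖d k‖) (r k)
  radius_fail : ∀ k, 1 ≤ k → ¬ β ≤ rhoHat θ f (x k) (d k) → r (k+1) = r k / ω₁
  eps_one : ε 1 = ‖gradient f (x 1)‖
  eps_succ_dec : ∀ k, 1 ≤ k → (f (x k + d k) : EReal) ≤ (f (x k) : EReal) + b k →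
    ε (k+1) = min (ε k) ‖gradient f (x k + d k)‖
  eps_succ_keep : ∀ k, 1 ≤ k → ¬ ((f (x k + d k) : EReal) ≤ (f (x k) : EReal) + b k) →
    ε (k+1) = ε k
  b_lb : ∀ k, 1 ≤ k → ((ξ * ε k * ‖d k‖ : ℝ) : EReal) ≤ b k

namespace SigmaCATTraj

variable {n : ℕ} {θ β ω₁ ω₂ γ₁ γ₂ γ₃ ξ σ : ℝ} {f : EuclideanSpace ℝ (Fin n) → ℝ}
  {x d : ℕ → EuclideanSpace ℝ (Fin n)} {r δ ε : ℕ → ℝ} {b : ℕ → EReal}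

theorem eps_succ_le (traj : SigmaCATTraj θ β ω₁ ω₂ γ₁ γ₂ γ₃ ξ σ f x d r δ ε b)
    {k : ℕ} (hk : 1 ≤ k) : ε (k + 1) ≤ ε k := by
  by_cases h : (f (x k + d k) : EReal) ≤ (f (x k) : EReal) + b k
  · rw [traj.eps_succ_dec k hk h]
    exact min_le_left _ _
  · exact (traj.eps_succ_keep k hk h).le

theorem eps_succ_le_norm_gradient (traj : SigmaCATTraj θ β ω₁ ω₂ γ₁ γ₂ γ₃ ξ σ f x d r δ ε b)
    {k : ℕ} (hk : 1 ≤ k) (hdec : f (x k + d k) ≤ f (x k)) :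
    ε (k + 1) ≤ ‖gradient f (x k + d k)‖ := by
  have h : (f (x k + d k) : EReal) ≤ (f (x k) : EReal) + b k :=
    (EReal.coe_le_coe_iff.2 hdec).trans (le_add_of_nonneg_right (traj.b_pos k hk).le)
  rw [traj.eps_succ_dec k hk h]
  exact min_le_right _ _

theorem eps_le_norm_gradient (traj : SigmaCATTraj θ β ω₁ ω₂ γ₁ γ₂ γ₃ ξ σ f x d r δ ε b)
    {k : ℕ} (hk : 1 ≤ k) : ε k ≤ ‖gradient f (x k)‖ := by
  induction k, hk using Nat.le_induction with
  | base => exact traj.eps_one.le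
  | succ k hk ih =>
    by_cases h : f (x k + d k) ≤ f (x k) ∧ σ ≤ rhoHat θ f (x k) (d k)
    · rw [traj.step_acc k hk h]
      exact traj.eps_succ_le_norm_gradient hk h.1
    · rw [traj.step_rej k hk h]
      exact (traj.eps_succ_le hk).trans ih

/-- The sufficient decrease provided by any step, accepted or rejected. -/
theorem mul_norm_step_le (traj : SigmaCATTraj θ β ω₁ ω₂ γ₁ γ₂ γ₃ ξ σ f x d r δ ε b)
    (hθ : 0 < θ) (hγ₃ : 0 < γ₃) (hσ : 0 < σ) {k : ℕ} (hk : 1 ≤ k) :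
    (θ * σ / 2) * ε (k + 1) * ‖x (k + 1) - x k‖ ≤ f (x k) - f (x (k + 1)) := by
  by_cases h : f (x k + d k) ≤ f (x k) ∧ σ ≤ rhoHat θ f (x k) (d k)
  · rw [traj.step_acc k hk h, add_sub_cancel_left]
    have hmodel : 0 ≤ -modelVal f (x k) (d k) := by
      have hδ := traj.δ_nonneg k hk
      have hpos : 0 ≤ γ₃ * (δ k / 2) * ‖d k‖ ^ 2 := by positivity
      linarith [traj.sub_decr k hk]
    have hmin : ε (k + 1) ≤ min ‖gradient f (x k)‖ ‖gradient f (x k + d k)‖ :=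
      le_min ((traj.eps_succ_le hk).trans (traj.eps_le_norm_gradient hk))
        (traj.eps_succ_le_norm_gradient hk h.1)
    have hρ := h.2
    unfold rhoHat at hρ
    set D := -(modelVal f (x k) (d k)) +
      (θ / 2) * min ‖gradient f (x k)‖ ‖gradient f (x k + d k)‖ * ‖d k‖ with hD
    have hlower : (θ / 2) * ε (k + 1) * ‖d k‖ ≤ D := by
      have : (θ / 2) * ε (k + 1) * ‖d k‖ ≤
          (θ / 2) * min ‖gradient f (x k)‖ ‖gradient f (x k + d k)‖ * ‖d k‖ := by gcongr
      linarith
    have hD_nonneg : 0 ≤ D := by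
      have hε := traj.ε_pos (k + 1) (by lia)
      exact le_trans (by positivity) hlower
    have hD_pos : 0 < D := by
      refine hD_nonneg.lt_of_ne' fun h0 => ?_
      rw [h0, div_zero] at hρ
      linarith
    rw [le_div_iff₀ hD_pos] at hρ
    calc (θ * σ / 2) * ε (k + 1) * ‖d k‖ = σ * ((θ / 2) * ε (k + 1) * ‖d k‖) := by ring
      _ ≤ σ * D := by gcongr
      _ ≤ _ := hρ
  · simp [traj.step_rej k hk h]

theorem mul_norm_sub_le (traj : SigmaCATTraj θ β ω₁ ω₂ γ₁ γ₂ γ₃ ξ σ f x d r δ ε b)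
    (hθ : 0 < θ) (hγ₃ : 0 < γ₃) (hσ : 0 < σ) {k : ℕ} (hk : 1 ≤ k) :
    (θ * σ / 2) * ε k * ‖x k - x 1‖ ≤ f (x 1) - f (x k) := by
  induction k, hk using Nat.le_induction with
  | base => simp
  | succ k hk ih =>
    have hε := traj.ε_pos (k + 1) (by lia)
    calc (θ * σ / 2) * ε (k + 1) * ‖x (k + 1) - x 1‖
        ≤ (θ * σ / 2) * ε (k + 1) * (‖x (k + 1) - x k‖ + ‖x k - x 1‖) := by
          gcongr
          exact norm_sub_le_norm_sub_add_norm_sub _ _ _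
      _ = (θ * σ / 2) * ε (k + 1) * ‖x (k + 1) - x k‖ +
          (θ * σ / 2) * ε (k + 1) * ‖x k - x 1‖ := mul_add _ _ _
      _ ≤ (f (x k) - f (x (k + 1))) + (θ * σ / 2) * ε k * ‖x k - x 1‖ := by
          gcongr
          · exact traj.mul_norm_step_le hθ hγ₃ hσ hk
          · exact traj.eps_succ_le hk
      _ ≤ f (x 1) - f (x (k + 1)) := by linarith

theorem eps_le_of_le (traj : SigmaCATTraj θ β ω₁ ω₂ γ₁ γ₂ γ₃ ξ σ f x d r δ ε b)
    {k m : ℕ} (hk : 1 ≤ k) (hkm : k ≤ m) : ε m ≤ ε k := by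
  induction m, hkm using Nat.le_induction with
  | base => exact le_rfl
  | succ m hkm ih => exact (traj.eps_succ_le (hk.trans hkm)).trans ih

end SigmaCATTraj

/-- inequality (19) of the paper and its consequence: total-movement
bound for a σ-CAT trajectory, and `ε_K → 0` when the iterates are unbounded. -/
theorem unbounded_iterates_eps_to_zero {n : ℕ} (hn : 1 ≤ n)
    (θ β ω₁ ω₂ γ₁ γ₂ γ₃ ξ σ Δf : ℝ)
    (hθ : 0 < θ ∧ θ < 1) (hβ : 0 < β ∧ β < 1)
    (hω₁ : 1 < ω₁) (hω₂ : ω₁ ≤ ω₂)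
    (hγ₃ : 0 < γ₃ ∧ γ₃ ≤ 1) (hγ₂ : ω₁⁻¹ < γ₂ ∧ γ₂ ≤ 1)
    (hγ₁ : 0 ≤ γ₁ ∧ γ₁ < (1/2) * (1 - β * θ / (γ₃ * (1 - β))))
    (hξ : 0 < ξ) (hσ : 0 < σ ∧ σ ≤ β)
    (f : EuclideanSpace ℝ (Fin n) → ℝ)
    (x d : ℕ → EuclideanSpace ℝ (Fin n)) (r δ ε : ℕ → ℝ) (b : ℕ → EReal)
    (traj : SigmaCATTraj θ β ω₁ ω₂ γ₁ γ₂ γ₃ ξ σ f x d r δ ε b)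
    (hΔf : 0 < Δf)
    (hbound : ∀ k, 1 ≤ k → f (x 1) - f (x k) ≤ Δf) :
    (∀ K : ℕ, 1 ≤ K → (θ * σ / 2) * ε (K+1) * ‖x (K+1) - x 1‖ ≤ Δf) ∧
    ((∀ R : ℝ, ∃ k : ℕ, 1 ≤ k ∧ R < ‖x k‖) → Tendsto ε atTop (nhds 0)) := by
  have hmove (k : ℕ) (hk : 1 ≤ k) : (θ * σ / 2) * ε k * ‖x k - x 1‖ ≤ Δf :=
    (traj.mul_norm_sub_le hθ.1 hγ₃.1 hσ.1 hk).trans (hbound k hk)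
  refine ⟨fun K _ => hmove (K + 1) (by lia), fun hunb => ?_⟩
  rw [Metric.tendsto_atTop]
  intro e he
  have hc : 0 < θ * σ / 2 * e := by
    have := hθ.1
    have := hσ.1
    positivity
  obtain ⟨k, hk, hlarge⟩ := hunb (Δf / (θ * σ / 2 * e) + ‖x 1‖)
  refine ⟨k, fun m hm => ?_⟩
  rw [Real.dist_0_eq_abs, abs_of_pos (traj.ε_pos m (hk.trans hm))]
  refine (traj.eps_le_of_le hk hm).trans_lt ?_
  by_contra! hek
  have hfar : Δf / (θ * σ / 2 * e) < ‖x k - x 1‖ := by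
    linarith [norm_sub_norm_le (x k) (x 1)]
  rw [div_lt_iff₀' hc] at hfar
  have hle : θ * σ / 2 * e * ‖x k - x 1‖ ≤ θ * σ / 2 * ε k * ‖x k - x 1‖ := by
    have := hθ.1
    have := hσ.1
    gcongr
  linarith [hmove k hk]
end
end

section
/- For a σ-CAT trajectory with σ ∈ (0, β], for every K ∈ ℕ: r_{K+1} ≤ max{r₁, max_{k ∈ A_K} ω₂·(‖x_k‖ + ‖x_{k+1}‖)}, where A_K := {k ≤ K : f(x_k + d_k) ≤ f(x_k) and ρ̂_k ≥ σ} is the set of accepted steps up to K (the maximum over an empty A_K being interpreted as r₁). In particular, if the sequence of iterates x_k is bounded, then the sequence of trust-region radii r_k is bounded. -/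
open scoped RealInnerProductSpace
open Filter

noncomputable section

/-- A positive ratio `ρ̂` with a nonpositive model value certifies that `f` decreases. -/
lemma le_of_rhoHat_pos {n : ℕ} {θ : ℝ} (hθ : 0 ≤ θ) {f : EuclideanSpace ℝ (Fin n) → ℝ}
    {x d : EuclideanSpace ℝ (Fin n)} (hM : modelVal f x d ≤ 0) (hρ : 0 < rhoHat θ f x d) :
    f (x + d) ≤ f x := by
  have hden : 0 ≤ -(modelVal f x d) +
      (θ / 2) * min ‖gradient f x‖ ‖gradient f (x + d)‖ * ‖d‖ :=
    add_nonneg (neg_nonneg.2 hM) (by positivity)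
  by_contra! h
  exact hρ.not_ge (div_nonpos_of_nonpos_of_nonneg (by linarith) hden)

namespace SigmaCATTraj

variable {n : ℕ} {θ β ω₁ ω₂ γ₁ γ₂ γ₃ ξ σ : ℝ} {f : EuclideanSpace ℝ (Fin n) → ℝ}
  {x d : ℕ → EuclideanSpace ℝ (Fin n)} {r δ ε : ℕ → ℝ} {b : ℕ → EReal}

lemma modelVal_nonpos (traj : SigmaCATTraj θ β ω₁ ω₂ γ₁ γ₂ γ₃ ξ σ f x d r δ ε b)
    (hγ₃ : 0 ≤ γ₃) {k : ℕ} (hk : 1 ≤ k) : modelVal f (x k) (d k) ≤ 0 := by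
  have hδ := traj.δ_nonneg k hk
  exact (traj.sub_decr k hk).trans (neg_nonpos.2 (by positivity))

lemma norm_step_le (traj : SigmaCATTraj θ β ω₁ ω₂ γ₁ γ₂ γ₃ ξ σ f x d r δ ε b) {k : ℕ}
    (hk : 1 ≤ k) (hacc : f (x k + d k) ≤ f (x k) ∧ σ ≤ rhoHat θ f (x k) (d k)) :
    ‖d k‖ ≤ ‖x k‖ + ‖x (k + 1)‖ := by
  have h : d k = x (k + 1) - x k := by rw [traj.step_acc k hk hacc, add_sub_cancel_left]
  rw [h, add_comm ‖x k‖]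
  exact norm_sub_le _ _

/-- Any bound `B` for `ω₂ (‖x k‖ + ‖x (k + 1)‖)` over the accepted steps up to `K` controls the
radius after step `K`. -/
lemma radius_le_max (traj : SigmaCATTraj θ β ω₁ ω₂ γ₁ γ₂ γ₃ ξ σ f x d r δ ε b)
    (hθ : 0 ≤ θ) (hβ : 0 < β) (hω₁ : 1 ≤ ω₁) (hω₂ : 0 ≤ ω₂) (hγ₃ : 0 ≤ γ₃) (hσ : σ ≤ β)
    {B : ℝ} (K : ℕ)
    (hB : ∀ k, 1 ≤ k → k ≤ K → f (x k + d k) ≤ f (x k) → σ ≤ rhoHat θ f (x k) (d k) →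
      ω₂ * (‖x k‖ + ‖x (k + 1)‖) ≤ B) :
    r (K + 1) ≤ max (r 1) B := by
  induction K with
  | zero => exact le_max_left _ _
  | succ K ih =>
    have hK : 1 ≤ K + 1 := Nat.le_add_left 1 K
    have hr : r (K + 1) ≤ max (r 1) B := ih fun k hk hkK => hB k hk (hkK.trans K.le_succ)
    by_cases hρ : β ≤ rhoHat θ f (x (K + 1)) (d (K + 1))
    · have hf := le_of_rhoHat_pos hθ (traj.modelVal_nonpos hγ₃ hK) (hβ.trans_le hρ)
      have hstep := traj.norm_step_le hK ⟨hf, hσ.trans hρ⟩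
      rw [traj.radius_succ _ hK hρ]
      refine max_le (le_max_of_le_right ?_) hr
      exact (mul_le_mul_of_nonneg_left hstep hω₂).trans
        (hB (K + 1) hK le_rfl hf (hσ.trans hρ))
    · rw [traj.radius_fail _ hK hρ]
      exact (div_le_self (traj.r_pos _ hK).le hω₁).trans hr

end SigmaCATTraj

/-- bound on the trust-region radius via the accepted iterates; bounded
iterates give bounded radii. -/
theorem radius_bounded_by_iterates {n : ℕ} (hn : 1 ≤ n) (θ β ω₁ ω₂ γ₁ γ₂ γ₃ ξ σ : ℝ)
    (hθ : 0 < θ ∧ θ < 1) (hβ : 0 < β ∧ β < 1)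
    (hω₁ : 1 < ω₁) (hω₂ : ω₁ ≤ ω₂)
    (hγ₃ : 0 < γ₃ ∧ γ₃ ≤ 1) (hγ₂ : ω₁⁻¹ < γ₂ ∧ γ₂ ≤ 1)
    (hγ₁ : 0 ≤ γ₁ ∧ γ₁ < (1/2) * (1 - β * θ / (γ₃ * (1 - β))))
    (hξ : 0 < ξ) (hσ : 0 < σ ∧ σ ≤ β)
    (f : EuclideanSpace ℝ (Fin n) → ℝ)
    (x d : ℕ → EuclideanSpace ℝ (Fin n)) (r δ ε : ℕ → ℝ) (b : ℕ → EReal)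
    (traj : SigmaCATTraj θ β ω₁ ω₂ γ₁ γ₂ γ₃ ξ σ f x d r δ ε b) :
    (∀ K : ℕ, 1 ≤ K →
      r (K+1) ≤ max (r 1)
        (sSup ((fun k => ω₂ * (‖x k‖ + ‖x (k+1)‖)) ''
          {k : ℕ | 1 ≤ k ∧ k ≤ K ∧
            f (x k + d k) ≤ f (x k) ∧ σ ≤ rhoHat θ f (x k) (d k)}))) ∧
    ((∃ R : ℝ, ∀ k : ℕ, 1 ≤ k → ‖x k‖ ≤ R) →
      ∃ R' : ℝ, ∀ k : ℕ, 1 ≤ k → r k ≤ R') := by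
  have hω₂' : 0 ≤ ω₂ := by linarith
  have key := fun {B : ℝ} => traj.radius_le_max (B := B) hθ.1.le hβ.1 hω₁.le hω₂' hγ₃.1.le hσ.2
  refine ⟨fun K _ => key K fun k hk hkK hf hρ => ?_, ?_⟩
  · refine le_csSup (Set.Finite.bddAbove (Set.Finite.image _ ?_)) ⟨k, ⟨hk, hkK, hf, hρ⟩, rfl⟩
    exact (Set.finite_Iic K).subset fun j hj => hj.2.1
  · rintro ⟨R, hR⟩
    refine ⟨max (r 1) (ω₂ * (R + R)), fun k hk => ?_⟩
    obtain ⟨K, rfl⟩ := Nat.exists_eq_add_of_le' hk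
    exact key K fun j hj _ _ _ =>
      mul_le_mul_of_nonneg_left (add_le_add (hR j hj) (hR (j + 1) (Nat.le_add_left 1 j))) hω₂'
end
end

section
/- Let f : ℝⁿ → ℝ be differentiable, c ∈ (0,∞), and let x_k ∈ ℝⁿ and η_k ∈ (0,∞) (k ≥ 1) be sequences satisfying x_{k+1} = x_k − η_k∇f(x_k) and f(x_{k+1}) ≤ f(x_k) − c·η_k·‖∇f(x_k)‖² for all k. Then for all j, K ∈ ℕ with j ≤ K: f(x_j) − f(x_{K+1}) ≥ c·‖x_{K+1} − x_j‖·min_{j ≤ k ≤ K} ‖∇f(x_k)‖. Consequently, if f(x₁) − f(x_k) ≤ Δ_f for all k (for some Δ_f ∈ (0,∞)) and the iterates are unbounded (sup_k ‖x_k‖ = ∞), then inf_{k ≥ j} ‖∇f(x_k)‖ = 0 for every j ∈ ℕ. -/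
/-- Along a sequence of steps `x (k+1) = x k - η k • v k` with sufficient decrease of `φ`, the total
decrease dominates `c` times the distance travelled times any lower bound of the `‖v k‖`. -/
theorem mul_norm_sub_mul_le_of_sufficient_decrease {E : Type*} [NormedAddCommGroup E]
    [NormedSpace ℝ E] {x v : ℕ → E} {φ η : ℕ → ℝ} {c m : ℝ} {j i : ℕ} (hc : 0 ≤ c) (hm : 0 ≤ m)
    (hη : ∀ k, j ≤ k → 0 ≤ η k)
    (hstep : ∀ k, j ≤ k → x (k + 1) = x k - η k • v k)
    (hdec : ∀ k, j ≤ k → φ (k + 1) ≤ φ k - c * η k * ‖v k‖ ^ 2)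
    (hji : j ≤ i) (hv : ∀ k, j ≤ k → k < i → m ≤ ‖v k‖) :
    c * ‖x i - x j‖ * m ≤ φ j - φ i := by
  induction i, hji using Nat.le_induction with
  | base => simp
  | succ i hji ih =>
    have hprev := ih fun k hjk hki => hv k hjk (by omega)
    have hmi : m ≤ ‖v i‖ := hv i hji (by omega)
    have htri : ‖x (i + 1) - x j‖ ≤ ‖x i - x j‖ + η i * ‖v i‖ := by
      have hsplit : x (i + 1) - x j = (x i - x j) - η i • v i := by
        rw [hstep i hji]
        abel
      calc ‖x (i + 1) - x j‖ ≤ ‖x i - x j‖ + ‖η i • v i‖ := hsplit ▸ norm_sub_le _ _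
        _ = ‖x i - x j‖ + η i * ‖v i‖ := by rw [norm_smul, Real.norm_of_nonneg (hη i hji)]
    calc c * ‖x (i + 1) - x j‖ * m
        ≤ c * (‖x i - x j‖ + η i * ‖v i‖) * m := by gcongr
      _ = c * ‖x i - x j‖ * m + c * η i * ‖v i‖ * m := by ring
      _ ≤ c * ‖x i - x j‖ * m + c * η i * ‖v i‖ * ‖v i‖ := by
        have := hη i hji
        gcongr
      _ ≤ φ j - φ (i + 1) := by linarith [hdec i hji]

/-- Case 1 of the Armijo proposition: under the sufficient-decrease
condition, the total decrease dominates `c · distance · (min gradient norm)`;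
consequently along unbounded iterates with bounded optimality gap the infimum of the
gradient norms past any index is `0`. -/
theorem sufficient_decrease_unbounded {n : ℕ} (hn : 1 ≤ n)
    (f : EuclideanSpace ℝ (Fin n) → ℝ) (hf : ∀ y, DifferentiableAt ℝ f y)
    (c : ℝ) (hc : 0 < c)
    (x : ℕ → EuclideanSpace ℝ (Fin n)) (η : ℕ → ℝ)
    (hη : ∀ k : ℕ, 1 ≤ k → 0 < η k)
    (hstep : ∀ k : ℕ, 1 ≤ k → x (k+1) = x k - η k • gradient f (x k))
    (hdec : ∀ k : ℕ, 1 ≤ k → f (x (k+1)) ≤ f (x k) - c * η k * ‖gradient f (x k)‖ ^ 2) :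
    (∀ (j K : ℕ) (_ : 1 ≤ j) (hjK : j ≤ K),
      c * ‖x (K+1) - x j‖ *
          ((Finset.Icc j K).inf' (Finset.nonempty_Icc.mpr hjK)
            fun k => ‖gradient f (x k)‖) ≤
        f (x j) - f (x (K+1))) ∧
    (∀ Δf : ℝ, 0 < Δf → (∀ k : ℕ, 1 ≤ k → f (x 1) - f (x k) ≤ Δf) →
      (∀ R : ℝ, ∃ k : ℕ, 1 ≤ k ∧ R < ‖x k‖) →
      ∀ j : ℕ, 1 ≤ j → (⨅ k : {k : ℕ // j ≤ k}, ‖gradient f (x k.1)‖) = 0) := by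
  have key : ∀ (m : ℝ) (j i : ℕ), 0 ≤ m → 1 ≤ j → j ≤ i →
      (∀ k, j ≤ k → k < i → m ≤ ‖gradient f (x k)‖) →
      c * ‖x i - x j‖ * m ≤ f (x j) - f (x i) := fun m j i hm hj hji hv =>
    mul_norm_sub_mul_le_of_sufficient_decrease (φ := fun k => f (x k)) hc.le hm
      (fun k hk => (hη k (hj.trans hk)).le) (fun k hk => hstep k (hj.trans hk))
      (fun k hk => hdec k (hj.trans hk)) hji hv
  refine ⟨fun j K hj hjK => key _ j (K + 1) ?_ hj (by omega) fun k hjk hkK => ?_, ?_⟩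
  · exact Finset.le_inf' _ _ fun k _ => norm_nonneg _
  · exact Finset.inf'_le _ (Finset.mem_Icc.mpr ⟨hjk, by omega⟩)
  intro Δf _ hgap hunb j hj
  set m := ⨅ k : {k : ℕ // j ≤ k}, ‖gradient f (x k.1)‖ with hm_def
  have hm0 : 0 ≤ m := Real.iInf_nonneg fun k => norm_nonneg _
  by_contra hne
  have hm : 0 < m := lt_of_le_of_ne hm0 (Ne.symm hne)
  have hle : ∀ k, j ≤ k → m ≤ ‖gradient f (x k)‖ := fun k hk =>
    ciInf_le (f := fun k : {k : ℕ // j ≤ k} => ‖gradient f (x k.1)‖)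
      ⟨0, by rintro _ ⟨k, rfl⟩; exact norm_nonneg _⟩ ⟨k, hk⟩
  have hj1 : f (x j) ≤ f (x 1) := by
    have := key 0 1 j le_rfl le_rfl hj fun k _ _ => norm_nonneg _
    linarith
  have htail : ∀ i, j ≤ i → ‖x i‖ ≤ ‖x j‖ + Δf / (c * m) := by
    intro i hi
    have hdist : ‖x i - x j‖ ≤ Δf / (c * m) := by
      rw [le_div_iff₀ (by positivity)]
      linarith [key m j i hm0 hj hi fun k hk _ => hle k hk, hgap i (hj.trans hi)]
    linarith [norm_le_norm_add_norm_sub' (x i) (x j)]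
  obtain ⟨i, -, hR⟩ := hunb (max (‖x j‖ + Δf / (c * m)) (∑ k ∈ Finset.range j, ‖x k‖))
  rw [max_lt_iff] at hR
  rcases le_or_gt j i with hi | hi
  · exact absurd (htail i hi) (not_le.mpr hR.1)
  · exact absurd (Finset.single_le_sum (f := fun k => ‖x k‖) (fun k _ => norm_nonneg _)
      (Finset.mem_range.mpr hi)) (not_le.mpr hR.2)
end

section
/- Let n ≥ 1, H a symmetric n×n real matrix with minimum eigenvalue λ, g ∈ ℝⁿ, γ₁, ε, r ∈ (0,∞), δ, δ' ∈ ℝ with δ ≤ −λ ≤ δ' and δ' − δ ≤ γ₁ε/(6r). Let d₀ ∈ ℝⁿ with ‖d₀‖ ≤ r and ‖Hd₀ + g + δ'd₀‖ ≤ γ₁ε/3, let y ∈ ℝⁿ be a unit vector with ‖Hy − λy‖ ≤ γ₁ε/(6r), and let α ∈ ℝ be such that ‖d₀ + αy‖ = r. Then, setting d := d₀ + αy, we have ‖Hd + g + δ'd‖ ≤ γ₁ε. -/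
/-- hard-case guarantee of the trust-region subproblem solver. If `λ` is
the minimum eigenvalue of the symmetric matrix `H`, `δ ≤ −λ ≤ δ'` with
`δ' − δ ≤ γ₁ε/(6r)`, `d₀` is a near-stationary point of the shifted model, `y` is an
approximate unit eigenvector for `λ`, and `α` is chosen so that `‖d₀ + αy‖ = r`, then
the returned direction `d = d₀ + αy` satisfies `‖Hd + g + δ'd‖ ≤ γ₁ε`. -/
theorem hard_case_guarantee {n : ℕ} (hn : 1 ≤ n)
    (H : Matrix (Fin n) (Fin n) ℝ) (hH : H.IsSymm) (lam : ℝ)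
    (hlam_eig : Module.End.HasEigenvalue (Matrix.toEuclideanLin H) lam)
    (hlam_min : ∀ μ : ℝ, Module.End.HasEigenvalue (Matrix.toEuclideanLin H) μ → lam ≤ μ)
    (g : EuclideanSpace ℝ (Fin n)) (γ₁ ε r δ δ' : ℝ)
    (hγ₁ : 0 < γ₁) (hε : 0 < ε) (hr : 0 < r)
    (hδlam : δ ≤ -lam) (hlamδ' : -lam ≤ δ') (hgap : δ' - δ ≤ γ₁ * ε / (6 * r))
    (d₀ : EuclideanSpace ℝ (Fin n)) (hd₀ : ‖d₀‖ ≤ r)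
    (hd₀grad : ‖Matrix.toEuclideanLin H d₀ + g + δ' • d₀‖ ≤ γ₁ * ε / 3)
    (y : EuclideanSpace ℝ (Fin n)) (hy : ‖y‖ = 1)
    (hy_eig : ‖Matrix.toEuclideanLin H y - lam • y‖ ≤ γ₁ * ε / (6 * r))
    (α : ℝ) (hα : ‖d₀ + α • y‖ = r) :
    ‖Matrix.toEuclideanLin H (d₀ + α • y) + g + δ' • (d₀ + α • y)‖ ≤ γ₁ * ε := by
  set c := γ₁ * ε / (6 * r) with hc
  have hcr : 2 * r * c = γ₁ * ε / 3 := by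
    rw [hc]
    field_simp
    norm_num
  have hα_le : |α| ≤ 2 * r := by
    have h : ‖α • y‖ ≤ ‖d₀ + α • y‖ + ‖d₀‖ := by
      simpa using norm_sub_le (d₀ + α • y) d₀
    rw [norm_smul, hy, mul_one, Real.norm_eq_abs] at h
    linarith
  have hc_nonneg : 0 ≤ c := by positivity
  have h_eig : ‖α • (Matrix.toEuclideanLin H y - lam • y)‖ ≤ γ₁ * ε / 3 := by
    rw [norm_smul, Real.norm_eq_abs, ← hcr]
    gcongr
  have h_shift : ‖(α * (lam + δ')) • y‖ ≤ γ₁ * ε / 3 := by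
    rw [norm_smul, hy, mul_one, norm_mul, Real.norm_eq_abs, Real.norm_eq_abs,
      abs_of_nonneg (by linarith : 0 ≤ lam + δ'), ← hcr]
    exact mul_le_mul hα_le (by linarith) (by linarith) (by positivity)
  have h_split : Matrix.toEuclideanLin H (d₀ + α • y) + g + δ' • (d₀ + α • y) =
      (Matrix.toEuclideanLin H d₀ + g + δ' • d₀) +
        α • (Matrix.toEuclideanLin H y - lam • y) + (α * (lam + δ')) • y := by
    rw [map_add, map_smul]
    module
  rw [h_split]
  refine norm_add₃_le.trans ?_
  linarith
end
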